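/- Let n = 2 + k_2 with k_2 ≥ 1, and let (q, q') be a two-period orbit in which q_i > 0 and q'_i > 0 for i ∈ {1, 2}, while q_j = 0 and q'_j > 0 for every j with 3 ≤ j ≤ 2 + k_2. Set S = (2(1 − k_2)A + 2Σ_{j=3}^{2+k_2} c_j − (c_1 + c_2))/(3 − 2k_2). Then q_1 = ((1 − k_2)A + k_2·S + Σ_{j=3}^{2+k_2} c_j + c_2 − 2c_1)/3, q_2 = ((1 − k_2)A + k_2·S + Σ_{j=3}^{2+k_2} c_j + c_1 − 2c_2)/3, q'_1 = (A − q_2 − c_1)/2, q'_2 = (A − q_1 − c_2)/2, and q'_j = (A − q_1 − q_2 − c_j)/2 for every j with 3 ≤ j ≤ 2 + k_2. -/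

import Mathlib

/-- Cournot best-response map. -/
noncomputable def BR (n : ℕ) (A : ℝ) (c : Fin n → ℝ) (q : Fin n → ℝ) : Fin n → ℝ :=
  fun i => max 0 ((A - ∑ j ∈ Finset.univ.erase i, q j - c i) / 2)

/-- An active best response solves its first-order condition. -/
theorem two_mul_eq_of_BR_pos {n : ℕ} {A : ℝ} {c q q' : Fin n → ℝ} (h : q' = BR n A c q)
    {i : Fin n} (hi : 0 < q' i) : 2 * q' i = A - (∑ j, q j - q i) - c i := by
  have hmax : q' i = max 0 ((A - ∑ j ∈ Finset.univ.erase i, q j - c i) / 2) := congrFun h i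
  have hsum := Finset.add_sum_erase Finset.univ q (Finset.mem_univ i)
  rcases max_cases 0 ((A - ∑ j ∈ Finset.univ.erase i, q j - c i) / 2) with h' | h' <;> linarith

theorem sum_filter_two_le_val {k : ℕ} (f : Fin (k + 2) → ℝ) :
    ∑ j ∈ Finset.univ.filter (fun j : Fin (k + 2) => 2 ≤ j.val), f j
      = ∑ j : Fin k, f j.succ.succ := by
  rw [Finset.sum_filter, Fin.sum_univ_succ, Fin.sum_univ_succ]
  simp

/-- explicit two-period orbit when exactly two firms are always active
(k₁ = 2). -/
theorem stmt_18 (k₂ : ℕ) (hk₂ : 1 ≤ k₂) (A : ℝ) (hA : 0 < A)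
    (c : Fin (k₂ + 2) → ℝ) (hc : ∀ i, 0 ≤ c i)
    (q q' : Fin (k₂ + 2) → ℝ) (hqnn : ∀ i, 0 ≤ q i) (hq'nn : ∀ i, 0 ≤ q' i)
    (h1 : q' = BR (k₂ + 2) A c q) (h2 : q = BR (k₂ + 2) A c q')
    (hpos : 0 < q 0 ∧ 0 < q' 0 ∧ 0 < q 1 ∧ 0 < q' 1)
    (hrest : ∀ j : Fin (k₂ + 2), 2 ≤ j.val → q j = 0 ∧ 0 < q' j)
    (S : ℝ)
    (hS : S = (2 * (1 - (k₂ : ℝ)) * A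
        + 2 * (∑ j ∈ Finset.univ.filter (fun j : Fin (k₂ + 2) => 2 ≤ j.val), c j)
        - (c 0 + c 1)) / (3 - 2 * (k₂ : ℝ))) :
    q 0 = ((1 - (k₂ : ℝ)) * A + (k₂ : ℝ) * S
        + (∑ j ∈ Finset.univ.filter (fun j : Fin (k₂ + 2) => 2 ≤ j.val), c j)
        + c 1 - 2 * c 0) / 3 ∧
    q 1 = ((1 - (k₂ : ℝ)) * A + (k₂ : ℝ) * S
        + (∑ j ∈ Finset.univ.filter (fun j : Fin (k₂ + 2) => 2 ≤ j.val), c j)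
        + c 0 - 2 * c 1) / 3 ∧
    q' 0 = (A - q 1 - c 0) / 2 ∧
    q' 1 = (A - q 0 - c 1) / 2 ∧
    (∀ j : Fin (k₂ + 2), 2 ≤ j.val → q' j = (A - q 0 - q 1 - c j) / 2) := by
  obtain ⟨p0, p0', p1, p1'⟩ := hpos
  have hsum (f : Fin (k₂ + 2) → ℝ) : ∑ j, f j = f 0 + f 1 + ∑ j : Fin k₂, f j.succ.succ := by
    rw [Fin.sum_univ_succ, Fin.sum_univ_succ, Fin.succ_zero_eq_one, ← add_assoc (f 0)]
  have hq : ∑ j, q j = q 0 + q 1 := by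
    rw [hsum, Finset.sum_eq_zero fun j _ => (hrest j.succ.succ (by simp)).1, add_zero]
  have e0' := two_mul_eq_of_BR_pos h1 p0'
  have e1' := two_mul_eq_of_BR_pos h1 p1'
  have e0 := two_mul_eq_of_BR_pos h2 p0
  have e1 := two_mul_eq_of_BR_pos h2 p1
  have ej (j : Fin (k₂ + 2)) (hj : 2 ≤ j.val) : q' j = (A - q 0 - q 1 - c j) / 2 := by
    have := two_mul_eq_of_BR_pos h1 (hrest j hj).2
    rw [hq, (hrest j hj).1] at this
    linarith
  have hq' : ∑ j : Fin k₂, q' j.succ.succ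
      = (k₂ * (A - q 0 - q 1) - ∑ j : Fin k₂, c j.succ.succ) / 2 := by
    rw [Finset.sum_congr rfl fun j _ => ej j.succ.succ (by simp), ← Finset.sum_div,
      Finset.sum_sub_distrib]
    simp [mul_sub]
  rw [hq] at e0' e1'
  rw [hsum, hq'] at e0 e1
  rw [sum_filter_two_le_val] at hS ⊢
  have hk : (3 - 2 * (k₂ : ℝ)) ≠ 0 := by
    intro h
    have : 2 * k₂ = 3 := by
      exact_mod_cast (by linarith : 2 * (k₂ : ℝ) = 3)
    omega
  have hSq : S = q 0 + q 1 := by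
    rw [hS, div_eq_iff hk]
    linarith
  subst hSq
  exact ⟨by linarith, by linarith, by linarith, by linarith, ej⟩
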